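/- Let F be a normal subgroup of a group π, and suppose h : π → Aff(ℝᵐ × ℝˡ) is an injective homomorphism such that for γ ∈ F, h(γ)(x,y) = (x, B_γ y + d_γ), and for γ₁ ∈ π, h(γ₁)(x,y) = (A_{γ₁} x + a_{γ₁}, B_{γ₁} y + C_{γ₁} x + d_{γ₁}). Then for every γ₁ ∈ π and every x ∈ ℝᵐ, the vector C_{γ₁}(x) is invariant under the linear action of F on ℝˡ: B_γ(C_{γ₁} x) = C_{γ₁} x for all γ ∈ F. -/

import Mathlib

/-- If `F` is normal in `π`, `h` is an injective homomorphism into the affine transformations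
of `ℝᵐ × ℝˡ` with `h(γ)(x,y) = (x, B_γ y + d_γ)` for `γ ∈ F` and
`h(γ₁)(x,y) = (A_{γ₁} x + a_{γ₁}, B_{γ₁} y + C_{γ₁} x + d_{γ₁})` in general,
then every vector `C_{γ₁} x` is fixed by the linear action of `F` on `ℝˡ`. -/
theorem stmt_6 {G : Type*} [Group G] {m l : ℕ}
    (A : G → (Fin m → ℝ) →ₗ[ℝ] (Fin m → ℝ)) (a : G → Fin m → ℝ)
    (B : G → (Fin l → ℝ) →ₗ[ℝ] (Fin l → ℝ))
    (C : G → (Fin m → ℝ) →ₗ[ℝ] (Fin l → ℝ)) (d : G → Fin l → ℝ)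
    (h : G → (Fin m → ℝ) × (Fin l → ℝ) → (Fin m → ℝ) × (Fin l → ℝ))
    (hh : ∀ γ p, h γ p = (A γ p.1 + a γ, B γ p.2 + C γ p.1 + d γ))
    (hhom : ∀ γ γ', h (γ * γ') = h γ ∘ h γ')
    (hinj : Function.Injective h)
    (F : Subgroup G) (hFnormal : F.Normal)
    (hF : ∀ γ ∈ F, A γ = LinearMap.id ∧ a γ = 0 ∧ C γ = 0) :
    ∀ γ₁ : G, ∀ x : Fin m → ℝ, ∀ γ ∈ F, B γ (C γ₁ x) = C γ₁ x := by
  intro γ₁ x γ hγ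
  have hγ' : γ₁⁻¹ * γ * γ₁ ∈ F := by
    simpa using hFnormal.conj_mem γ hγ γ₁⁻¹
  obtain ⟨-, -, hC⟩ := hF γ hγ
  obtain ⟨hA', ha', hC'⟩ := hF _ hγ'
  have hcomm : h γ ∘ h γ₁ = h γ₁ ∘ h (γ₁⁻¹ * γ * γ₁) := by
    rw [← hhom, ← hhom]
    congr 1
    group
  have key (z : Fin m → ℝ) :
      B γ (C γ₁ z) + B γ (d γ₁) + d γ = B γ₁ (d (γ₁⁻¹ * γ * γ₁)) + C γ₁ z + d γ₁ := by
    simpa [hh, hC, hA', ha', hC'] using congrArg Prod.snd (congrFun hcomm (z, 0))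
  have h₀ := key 0
  simp only [map_zero, zero_add, add_zero] at h₀
  have hx := key x
  rw [add_assoc, h₀, add_right_comm, add_comm] at hx
  exact add_left_cancel hx
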